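/- arXiv:2410.17297 — 3 statements merged into one kernel-verified Lean document; each statement's English description precedes it below -/
import Mathlib

section
/- Under Assumption 1, let γ > 0, let λ be a constant with 0 < λ ≤ min{1/4, a/(4L + γ²)}, and let Å be a constant with Å ≥ K + 2λ(B²/(2L) + A), where K = b + B²/(2a). Then for every x ∈ ℝ^d: ⟨x, ∇f(x)⟩ ≥ 2λ( f(x) + (γ²/4)|x|² ) − Å. -/
open scoped RealInnerProductSpace

/-- The quadratic upper bound for a function with `L`-Lipschitz gradient, based at the origin. -/
theorem le_quadratic_of_lipschitz_gradient {E : Type*} [NormedAddCommGroup E]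
    [InnerProductSpace ℝ E] [CompleteSpace E] {f : E → ℝ} {g : E → E} {L : ℝ}
    (hgrad : ∀ x, HasGradientAt f (g x) x) (hLip : ∀ x y, ‖g x - g y‖ ≤ L * ‖x - y‖) (x : E) :
    f x ≤ f 0 + ⟪x, g 0⟫ + L / 2 * ‖x‖ ^ 2 := by
  let h : ℝ → ℝ := fun t => f (t • x) - t * ⟪x, g 0⟫ - L / 2 * ‖x‖ ^ 2 * t ^ 2
  have hderiv (t : ℝ) :
      HasDerivAt h (⟪g (t • x), x⟫ - ⟪x, g 0⟫ - L / 2 * ‖x‖ ^ 2 * (2 * t)) t := by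
    have hline : HasDerivAt (fun t : ℝ => t • x) x t := by
      simpa using (hasDerivAt_id t).smul_const x
    have hf : HasDerivAt (fun t : ℝ => f (t • x)) ⟪g (t • x), x⟫ t := by
      simpa [Function.comp_def] using (hgrad (t • x)).hasFDerivAt.comp_hasDerivAt t hline
    have hlin : HasDerivAt (fun t : ℝ => t * ⟪x, g 0⟫) ⟪x, g 0⟫ t := by
      simpa using (hasDerivAt_id t).mul_const ⟪x, g 0⟫
    have hsq : HasDerivAt (fun t : ℝ => t ^ 2) (2 * t) t := by
      simpa using hasDerivAt_pow 2 t
    exact (hf.sub hlin).sub (hsq.const_mul _)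
  have hanti : AntitoneOn h (Set.Icc 0 1) := by
    refine antitoneOn_of_hasDerivWithinAt_nonpos (convex_Icc 0 1)
      (fun t _ => (hderiv t).continuousAt.continuousWithinAt)
      (fun t _ => (hderiv t).hasDerivWithinAt) fun t ht => ?_
    rw [interior_Icc] at ht
    have hinner : ⟪x, g (t • x) - g 0⟫ ≤ ‖x‖ * (L * (t * ‖x‖)) := by
      refine (real_inner_le_norm _ _).trans ?_
      gcongr
      simpa [norm_smul, abs_of_pos ht.1] using hLip (t • x) 0
    rw [inner_sub_right] at hinner
    rw [real_inner_comm]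
    linarith
  have h01 := hanti (Set.left_mem_Icc.2 zero_le_one) (Set.right_mem_Icc.2 zero_le_one) zero_le_one
  simp only [h, one_smul, zero_smul] at h01
  linarith

/-- Young's inequality with a weight `c`. -/
theorem mul_le_half_mul_sq_add_sq_div {c : ℝ} (hc : 0 < c) (r s : ℝ) :
    s * r ≤ c / 2 * r ^ 2 + s ^ 2 / (2 * c) := by
  have key : c / 2 * r ^ 2 + s ^ 2 / (2 * c) - s * r = (c * r - s) ^ 2 / (2 * c) := by
    field_simp
    ring
  have : 0 ≤ (c * r - s) ^ 2 / (2 * c) := by positivity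
  linarith

/-- Under Assumption 1, with `0 < λ ≤ min{1/4, a/(4L+γ²)}` and
`Aring ≥ K + 2λ(B²/(2L) + A)` where `K = b + B²/(2a)`, one has
`⟨x, ∇f(x)⟩ ≥ 2λ(f(x) + (γ²/4)|x|²) − Aring` for every `x`. -/
theorem dissipativity_lyapunov_of_assumption1
    (d : ℕ) (f : EuclideanSpace ℝ (Fin d) → ℝ)
    (g : EuclideanSpace ℝ (Fin d) → EuclideanSpace ℝ (Fin d))
    (A B L a b : ℝ) (hA : 0 ≤ A) (hB : 0 ≤ B) (hL : 0 < L) (ha : 0 < a) (hb : 0 < b)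
    (hf_nonneg : ∀ x, 0 ≤ f x)
    (hgrad : ∀ x, HasGradientAt f (g x) x)
    (hf0 : |f 0| ≤ A) (hg0 : ‖g 0‖ ≤ B)
    (hLip : ∀ x y, ‖g x - g y‖ ≤ L * ‖x - y‖)
    (hDiss : ∀ x y, ⟪x - y, g x - g y⟫ ≥ a * ‖x - y‖ ^ 2 - b)
    (γ lam Aring : ℝ) (hγ : 0 < γ)
    (hlam0 : 0 < lam) (hlam1 : lam ≤ min (1 / 4) (a / (4 * L + γ ^ 2)))
    (hAring : Aring ≥ (b + B ^ 2 / (2 * a)) + 2 * lam * (B ^ 2 / (2 * L) + A))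
    (x : EuclideanSpace ℝ (Fin d)) :
    ⟪x, g x⟫ ≥ 2 * lam * (f x + γ ^ 2 / 4 * ‖x‖ ^ 2) - Aring := by
  have hinner : |⟪x, g 0⟫| ≤ B * ‖x‖ := by
    rw [mul_comm]
    exact (abs_real_inner_le_norm x (g 0)).trans (by gcongr)
  obtain ⟨hlow, hup⟩ := abs_le.1 hinner
  have hdiss : a / 2 * ‖x‖ ^ 2 - (b + B ^ 2 / (2 * a)) ≤ ⟪x, g x⟫ := by
    have h0 := hDiss x 0
    rw [sub_zero, inner_sub_right] at h0
    linarith [mul_le_half_mul_sq_add_sq_div ha ‖x‖ B]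
  have hquad : f x ≤ A + B ^ 2 / (2 * L) + L * ‖x‖ ^ 2 := by
    linarith [le_quadratic_of_lipschitz_gradient hgrad hLip x, le_of_abs_le hf0,
      mul_le_half_mul_sq_add_sq_div hL ‖x‖ B]
  have hlam : lam * (4 * L + γ ^ 2) ≤ a :=
    (le_div_iff₀ (by positivity)).1 (hlam1.trans (min_le_right _ _))
  have hscaled := mul_le_mul_of_nonneg_left hquad hlam0.le
  have hnorm := mul_le_mul_of_nonneg_right hlam (sq_nonneg ‖x‖)
  linarith
end

section
/- Let f : ℝ^d → ℝ be a nonnegative function, let γ > 0 and let λ be a constant with 0 < λ ≤ 1/4. Then for all m, x ∈ ℝ^d: max{ ((1 − 2λ)/(4(1 − λ))) |m|² , (γ²/8)(1 − 2λ) |x|² } ≤ 𝒱(m, x), where 𝒱(m, x) = f(x) + (γ²/4)( |x + m/γ|² + |m/γ|² − λ|x|² ). -/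
section CompletingTheSquare

variable {E : Type*} [NormedAddCommGroup E] [InnerProductSpace ℝ E]

theorem norm_add_smul_sq_real (x p : E) (a : ℝ) :
    ‖p + a • x‖ ^ 2 = ‖p‖ ^ 2 + 2 * a * inner ℝ p x + a ^ 2 * ‖x‖ ^ 2 := by
  rw [norm_add_sq_real, real_inner_smul_right, norm_smul, mul_pow, Real.norm_eq_abs, sq_abs]
  ring

theorem mul_norm_sq_right_le_norm_add_sq_add_sub {c : ℝ} (hc : c < 1) (x p : E) :
    (1 - 2 * c) / (1 - c) * ‖p‖ ^ 2 ≤ ‖x + p‖ ^ 2 + ‖p‖ ^ 2 - c * ‖x‖ ^ 2 := by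
  have hc' : 0 < 1 - c := sub_pos.2 hc
  rw [div_mul_eq_mul_div, div_le_iff₀ hc']
  have hsq := norm_add_smul_sq_real x p (1 - c)
  rw [add_comm x p, norm_add_sq_real]
  nlinarith [sq_nonneg ‖p + (1 - c) • x‖]

theorem mul_norm_sq_left_le_norm_add_sq_add_sub (c : ℝ) (x p : E) :
    (1 - 2 * c) / 2 * ‖x‖ ^ 2 ≤ ‖x + p‖ ^ 2 + ‖p‖ ^ 2 - c * ‖x‖ ^ 2 := by
  have hsq := norm_add_smul_sq_real x p (1 / 2)
  rw [add_comm x p, norm_add_sq_real]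
  nlinarith [sq_nonneg ‖p + (1 / 2 : ℝ) • x‖]

end CompletingTheSquare


/-- For a nonnegative `f`, `γ > 0` and `0 < λ ≤ 1/4`, the Lyapunov function
`𝒱(m, x) = f(x) + (γ²/4)(|x + m/γ|² + |m/γ|² − λ|x|²)` satisfies
`max{((1−2λ)/(4(1−λ)))|m|², (γ²/8)(1−2λ)|x|²} ≤ 𝒱(m, x)`. -/
theorem lyapunov_lower_bound
    (d : ℕ) (f : EuclideanSpace ℝ (Fin d) → ℝ) (hf_nonneg : ∀ x, 0 ≤ f x)
    (γ lam : ℝ) (hγ : 0 < γ) (hlam0 : 0 < lam) (hlam1 : lam ≤ 1 / 4)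
    (m x : EuclideanSpace ℝ (Fin d)) :
    max ((1 - 2 * lam) / (4 * (1 - lam)) * ‖m‖ ^ 2) (γ ^ 2 / 8 * (1 - 2 * lam) * ‖x‖ ^ 2) ≤
      f x + γ ^ 2 / 4 * (‖x + γ⁻¹ • m‖ ^ 2 + ‖γ⁻¹ • m‖ ^ 2 - lam * ‖x‖ ^ 2) := by
  have hm : ‖m‖ ^ 2 = γ ^ 2 * ‖γ⁻¹ • m‖ ^ 2 := by
    rw [norm_smul, mul_pow, Real.norm_eq_abs, sq_abs]
    field_simp
  have hγ4 : 0 ≤ γ ^ 2 / 4 := by positivity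
  have h_right := mul_le_mul_of_nonneg_left
    (mul_norm_sq_right_le_norm_add_sq_add_sub (c := lam) (by linarith) x (γ⁻¹ • m)) hγ4
  have h_left := mul_le_mul_of_nonneg_left
    (mul_norm_sq_left_le_norm_add_sq_add_sub lam x (γ⁻¹ • m)) hγ4
  refine max_le ?_ ?_
  · rw [hm, mul_comm 4 (1 - lam), ← div_div]
    linarith [hf_nonneg x]
  · linarith [hf_nonneg x]
end

section
/- Under Assumption 1, let γ > 0, β > 0, let λ be a constant with 0 < λ ≤ min{1/4, a/(4L + γ²)}, and let Å be a constant with Å ≥ K + 2λ(B²/(2L) + A), where K = b + B²/(2a). Then for all m, x ∈ ℝ^d: −⟨m + (γ/2)x, γm + ∇f(x)⟩ + ⟨∇f(x) + (γ²(1 − λ)/2)x + (γ/2)m, m⟩ + (dβ²)/2 ≤ −λγ 𝒱(m, x) + (γÅ + dβ²)/2. (The left-hand side equals 𝒜𝒱(m, x), where 𝒜 is the generator of the underdamped Langevin diffusion, 𝒜h = −⟨∇_m h, γm + ∇f(x)⟩ + ⟨∇_x h, m⟩ + (β²/2)Δ_m h.) -/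
open scoped RealInnerProductSpace

/-- The descent lemma: a function with `L`-Lipschitz gradient lies below its tangent paraboloids. -/
theorem le_add_inner_add_sq_of_lipschitz_gradient
    {E : Type*} [NormedAddCommGroup E] [InnerProductSpace ℝ E] [CompleteSpace E]
    {f : E → ℝ} {g : E → E} {L : ℝ} (hgrad : ∀ x, HasGradientAt f (g x) x)
    (hLip : ∀ x y, ‖g x - g y‖ ≤ L * ‖x - y‖) (x v : E) :
    f (x + v) ≤ f x + ⟪g x, v⟫ + L / 2 * ‖v‖ ^ 2 := by
  have hderiv (t : ℝ) : HasDerivAt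
      (fun t : ℝ => f (x + t • v) - t * ⟪g x, v⟫ - L / 2 * ‖v‖ ^ 2 * t ^ 2)
      (⟪g (x + t • v), v⟫ - ⟪g x, v⟫ - L * ‖v‖ ^ 2 * t) t := by
    have hline : HasDerivAt (fun t : ℝ => x + t • v) v t := by
      simpa using ((hasDerivAt_id t).smul_const v).const_add x
    have hcomp : HasDerivAt (fun t : ℝ => f (x + t • v)) ⟪g (x + t • v), v⟫ t := by
      simpa [Function.comp_def] using
        (hgrad (x + t • v)).hasFDerivAt.comp_hasDerivAt t hline
    refine ((hcomp.sub ((hasDerivAt_id t).mul_const ⟪g x, v⟫)).sub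
      ((hasDerivAt_pow 2 t).const_mul (L / 2 * ‖v‖ ^ 2))).congr_deriv ?_
    push_cast
    ring
  have hanti : AntitoneOn
      (fun t : ℝ => f (x + t • v) - t * ⟪g x, v⟫ - L / 2 * ‖v‖ ^ 2 * t ^ 2) (Set.Ici 0) := by
    refine antitoneOn_of_deriv_nonpos (convex_Ici 0)
      (fun t _ => (hderiv t).continuousAt.continuousWithinAt)
      (fun t _ => (hderiv t).differentiableAt.differentiableWithinAt) fun t ht => ?_
    rw [interior_Ici, Set.mem_Ioi] at ht
    have hstep := hLip (x + t • v) x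
    rw [add_sub_cancel_left, norm_smul, Real.norm_of_nonneg ht.le] at hstep
    have hinner := real_inner_le_norm (g (x + t • v) - g x) v
    rw [inner_sub_left] at hinner
    have hmul := mul_le_mul_of_nonneg_right hstep (norm_nonneg v)
    rw [(hderiv t).deriv]
    linarith
  have hle := hanti (Set.mem_Ici.2 le_rfl) (Set.mem_Ici.2 zero_le_one) zero_le_one
  simp only [one_smul, zero_smul, add_zero, one_mul, zero_mul, one_pow, mul_one] at hle
  linarith

/-- Young's inequality with weight `c`. -/
theorem mul_le_sq_div_add_mul_sq {c : ℝ} (hc : 0 < c) (s t : ℝ) :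
    s * t ≤ s ^ 2 / (2 * c) + c / 2 * t ^ 2 := by
  have hsq : s ^ 2 / (2 * c) + c / 2 * t ^ 2 - s * t = (s - c * t) ^ 2 / (2 * c) := by
    field_simp
    ring
  have : 0 ≤ (s - c * t) ^ 2 / (2 * c) := by positivity
  linarith

/-- Under Assumption 1, for `0 < λ ≤ min{1/4, a/(4L+γ²)}` and
`Å ≥ K + 2λ(B²/(2L) + A)` with `K = b + B²/(2a)`, the generator of the underdamped
Langevin diffusion applied to the Lyapunov function
`𝒱(m, x) = f(x) + (γ²/4)(|x + m/γ|² + |m/γ|² − λ|x|²)` satisfies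
`𝒜𝒱(m,x) = −⟨m + (γ/2)x, γm + ∇f(x)⟩ + ⟨∇f(x) + (γ²(1−λ)/2)x + (γ/2)m, m⟩ + dβ²/2
  ≤ −λγ𝒱(m,x) + (γÅ + dβ²)/2`. -/
theorem generator_lyapunov_bound
    (d : ℕ) (f : EuclideanSpace ℝ (Fin d) → ℝ)
    (g : EuclideanSpace ℝ (Fin d) → EuclideanSpace ℝ (Fin d))
    (A B L a b : ℝ) (hA : 0 ≤ A) (hB : 0 ≤ B) (hL : 0 < L) (ha : 0 < a) (hb : 0 < b)
    (hf_nonneg : ∀ x, 0 ≤ f x)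
    (hgrad : ∀ x, HasGradientAt f (g x) x)
    (hf0 : |f 0| ≤ A) (hg0 : ‖g 0‖ ≤ B)
    (hLip : ∀ x y, ‖g x - g y‖ ≤ L * ‖x - y‖)
    (hDiss : ∀ x y, ⟪x - y, g x - g y⟫ ≥ a * ‖x - y‖ ^ 2 - b)
    (γ β lam Aring : ℝ) (hγ : 0 < γ) (hβ : 0 < β)
    (hlam0 : 0 < lam) (hlam1 : lam ≤ min (1 / 4) (a / (4 * L + γ ^ 2)))
    (hAring : Aring ≥ (b + B ^ 2 / (2 * a)) + 2 * lam * (B ^ 2 / (2 * L) + A))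
    (m x : EuclideanSpace ℝ (Fin d)) :
    -⟪m + (γ / 2) • x, γ • m + g x⟫ +
        ⟪g x + (γ ^ 2 * (1 - lam) / 2) • x + (γ / 2) • m, m⟫ + d * β ^ 2 / 2 ≤
      -(lam * γ) *
          (f x + γ ^ 2 / 4 * (‖x + γ⁻¹ • m‖ ^ 2 + ‖γ⁻¹ • m‖ ^ 2 - lam * ‖x‖ ^ 2)) +
        (γ * Aring + d * β ^ 2) / 2 := by
  obtain ⟨hlam_quarter, hlam_div⟩ := le_min_iff.1 hlam1
  have hlam_mul : lam * (4 * L + γ ^ 2) ≤ a := (le_div_iff₀ (by positivity)).1 hlam_div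
  have hinner0 : |⟪g 0, x⟫| ≤ B * ‖x‖ :=
    (abs_real_inner_le_norm _ _).trans (mul_le_mul_of_nonneg_right hg0 (norm_nonneg x))
  obtain ⟨hinner0_lower, hinner0_upper⟩ := abs_le.1 hinner0
  have hf_upper : f x ≤ A + B ^ 2 / (2 * L) + L * ‖x‖ ^ 2 := by
    have hdesc := le_add_inner_add_sq_of_lipschitz_gradient hgrad hLip 0 x
    rw [zero_add] at hdesc
    linarith [le_of_abs_le hf0, mul_le_sq_div_add_mul_sq hL B ‖x‖]
  have hg_lower : a / 2 * ‖x‖ ^ 2 - (b + B ^ 2 / (2 * a)) ≤ ⟪g x, x⟫ := by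
    have hdiss0 := hDiss x 0
    rw [sub_zero, inner_sub_right, real_inner_comm (g x) x, real_inner_comm (g 0) x] at hdiss0
    linarith [mul_le_sq_div_add_mul_sq ha B ‖x‖]
  have hlhs : -⟪m + (γ / 2) • x, γ • m + g x⟫ +
      ⟪g x + (γ ^ 2 * (1 - lam) / 2) • x + (γ / 2) • m, m⟫ =
      -(γ / 2) * ‖m‖ ^ 2 - γ / 2 * ⟪g x, x⟫ - γ ^ 2 * lam / 2 * ⟪x, m⟫ := by
    simp only [inner_add_left, inner_add_right, real_inner_smul_left, real_inner_smul_right,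
      real_inner_self_eq_norm_sq]
    rw [real_inner_comm (g x) m, real_inner_comm (g x) x]
    ring
  have hrhs : γ ^ 2 / 4 * (‖x + γ⁻¹ • m‖ ^ 2 + ‖γ⁻¹ • m‖ ^ 2 - lam * ‖x‖ ^ 2) =
      γ ^ 2 / 4 * (1 - lam) * ‖x‖ ^ 2 + γ / 2 * ⟪x, m⟫ + ‖m‖ ^ 2 / 2 := by
    rw [norm_add_sq_real, real_inner_smul_right, norm_smul, Real.norm_of_nonneg (by positivity)]
    field_simp
    ring
  have hkey : 2 * lam * f x + lam * γ ^ 2 / 2 * (1 - lam) * ‖x‖ ^ 2 ≤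
      (1 - lam) * ‖m‖ ^ 2 + ⟪g x, x⟫ + Aring := by
    have hf_scaled := mul_le_mul_of_nonneg_left hf_upper (by positivity : 0 ≤ 2 * lam)
    have hcoef := mul_le_mul_of_nonneg_right hlam_mul (sq_nonneg ‖x‖)
    have hlam_sq : 0 ≤ lam ^ 2 * γ ^ 2 * ‖x‖ ^ 2 := by positivity
    have hm : 0 ≤ (1 - lam) * ‖m‖ ^ 2 := mul_nonneg (by linarith) (sq_nonneg _)
    linarith
  have hkey_scaled := mul_le_mul_of_nonneg_left hkey (by positivity : 0 ≤ γ / 2)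
  rw [hlhs, hrhs]
  linarith
end
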